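/- arXiv:2203.05304 — 3 statements merged into one kernel-verified Lean document; each statement's English description precedes it below -/
import Mathlib

section
/- For every nonempty closed convex set Ω ⊆ ℝⁿ and all p, q ∈ ℝⁿ, the function V(p,q) = ½(‖p − P_Ω(q)‖² − ‖p − P_Ω(p)‖²) satisfies V(p,q) ≥ ½‖P_Ω(p) − P_Ω(q)‖². -/
/-- For a nonempty closed convex set `Ω ⊆ ℝⁿ` and all `p, q ∈ ℝⁿ`, the function
`V(p,q) = ½(‖p − P_Ω q‖² − ‖p − P_Ω p‖²)` satisfies `V(p,q) ≥ ½‖P_Ω p − P_Ω q‖²`. -/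
theorem stmt_3 (n : ℕ) (Ω : Set (EuclideanSpace ℝ (Fin n)))
    (hne : Ω.Nonempty) (hcl : IsClosed Ω) (hconv : Convex ℝ Ω)
    (P : EuclideanSpace ℝ (Fin n) → EuclideanSpace ℝ (Fin n))
    (hP : ∀ p, P p ∈ Ω ∧ ∀ q ∈ Ω, ‖p - P p‖ ≤ ‖p - q‖)
    (p q : EuclideanSpace ℝ (Fin n)) :
    (1 / 2 : ℝ) * (‖p - P q‖ ^ 2 - ‖p - P p‖ ^ 2) ≥ (1 / 2 : ℝ) * ‖P p - P q‖ ^ 2 := by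
  have : Nonempty Ω := hne.to_subtype
  have hmin : ‖p - P p‖ = ⨅ w : Ω, ‖p - w‖ :=
    le_antisymm (le_ciInf fun w => (hP p).2 w w.2)
      (ciInf_le ⟨0, Set.forall_mem_range.2 fun _ => norm_nonneg _⟩ (⟨P p, (hP p).1⟩ : Ω))
  have hinner := (norm_eq_iInf_iff_real_inner_le_zero hconv (hP p).1).1 hmin (P q) (hP q).1
  have hexpand := norm_sub_sq_real (p - P p) (P q - P p)
  rw [sub_sub_sub_cancel_right, norm_sub_rev (P q) (P p)] at hexpand
  linarith
end

section
/- (Optimality condition for the resource allocation problem.) For i = 1,…,N let f_i : ℝⁿ → ℝ be convex, let Ω_i ⊆ ℝⁿ be nonempty closed convex, let d_i ∈ ℝⁿ, and assume Slater's condition: there exist x_i in the interior of Ω_i with Σᵢ x_i = Σᵢ d_i. Then a point y* = (y_1*,…,y_N*) with y_i* ∈ Ω_i for each i is an optimal solution of the resource allocation problem if and only if Σᵢ y_i* = Σᵢ d_i and there exists s ∈ ℝⁿ such that for each i there is a subgradient g_i of f_i at y_i* satisfying ⟨g_i − s, z − y_i*⟩ ≥ 0 for all z ∈ Ω_i. 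-/
open RealInnerProductSpace

section ConvexDuality

variable {E : Type*} [NormedAddCommGroup E] [InnerProductSpace ℝ E] [FiniteDimensional ℝ E]

/-- A convex function that lies above an affine function on a convex set `S`, with equality at
`y ∈ S`, has a subgradient at `y` whose affine minorant dominates that affine function on `S`. -/
lemma ConvexOn.exists_subgradient_of_affine_le {f : E → ℝ} (hf : ConvexOn ℝ Set.univ f)
    {S : Set E} (hS : Convex ℝ S) {y s : E} (hy : y ∈ S)
    (h : ∀ z ∈ S, f y + ⟪s, z - y⟫ ≤ f z) :
    ∃ g : E, (∀ z, f y + ⟪g, z - y⟫ ≤ f z) ∧ ∀ z ∈ S, 0 ≤ ⟪g - s, z - y⟫ := by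
  have hcont : Continuous f := continuousOn_univ.1 (hf.continuousOn isOpen_univ)
  let A : Set (E × ℝ) := {p | f p.1 < p.2}
  let B : Set (E × ℝ) := {p | p.1 ∈ S ∧ p.2 = f y + ⟪s, p.1 - y⟫}
  have hA : Convex ℝ A := by simpa [A] using hf.convex_strict_epigraph
  have hAo : IsOpen A := isOpen_lt (hcont.comp continuous_fst) continuous_snd
  have hB : Convex ℝ B := by
    rintro ⟨p, t⟩ ⟨hp, hpt⟩ ⟨q, r⟩ ⟨hq, hqr⟩ a b ha hb hab
    dsimp only at hpt hqr
    subst hpt hqr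
    refine ⟨hS hp hq ha hb hab, ?_⟩
    obtain rfl : b = 1 - a := by linarith
    simp only [Prod.smul_mk, Prod.mk_add_mk, smul_eq_mul, inner_sub_right, inner_add_right,
      inner_smul_right]
    ring
  have hAB : Disjoint A B := by
    rw [Set.disjoint_left]
    rintro ⟨p, t⟩ hp ⟨hpS, hpt⟩
    have hfp : f p < t := hp
    have := h p hpS
    simp only at hpt
    linarith
  obtain ⟨F, u, hFA, hFB⟩ := geometric_hahn_banach_open hA hAo hB hAB
  set L : StrongDual ℝ E := F.comp (ContinuousLinearMap.inl ℝ E ℝ)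
  set c : ℝ := F (0, 1)
  have hF (z : E) (t : ℝ) : F (z, t) = L z + c * t := by
    have : (z, t) = (z, (0 : ℝ)) + t • ((0 : E), (1 : ℝ)) := by simp
    rw [this, map_add, map_smul, smul_eq_mul, mul_comm]
    rfl
  have hlow (z : E) (hz : z ∈ S) : u ≤ L z + c * (f y + ⟪s, z - y⟫) := by
    rw [← hF]
    exact hFB _ ⟨hz, rfl⟩
  have hup (z : E) (t : ℝ) (ht : f z < t) : L z + c * t < u := by
    rw [← hF]
    exact hFA _ ht
  have hyu : u ≤ L y + c * f y := by simpa using hlow y hy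
  have hcneg : c < 0 := by
    have := hup y (f y + 1) (by linarith)
    linarith
  have hle (z : E) : L z + c * f z ≤ u := by
    refine le_of_forall_pos_le_add fun ε hε => ?_
    have := hup z (f z + ε / -c) (by linarith [div_pos hε (neg_pos.2 hcneg)])
    have hε' : c * (ε / -c) = -ε := by field_simp [hcneg.ne]
    linarith
  obtain ⟨v, hv⟩ := (InnerProductSpace.toDual ℝ E).surjective L
  have hLv (z : E) : L z = ⟪v, z⟫ := by rw [← hv, InnerProductSpace.toDual_apply_apply]
  obtain ⟨g, rfl⟩ : ∃ g : E, v = (-c) • g :=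
    ⟨(-c)⁻¹ • v, by rw [smul_inv_smul₀ (neg_pos.2 hcneg).ne']⟩
  have hLg (z : E) : L z - L y = -c * ⟪g, z - y⟫ := by
    rw [← map_sub, hLv, real_inner_smul_left]
  refine ⟨g, fun z => ?_, fun z hz => ?_⟩
  · refine le_of_mul_le_mul_left ?_ (neg_pos.2 hcneg)
    linarith [hle z, hLg z]
  · refine nonneg_of_mul_nonneg_right (a := -c) ?_ (neg_pos.2 hcneg)
    rw [inner_sub_left]
    linarith [hlow z hz, hLg z, hle y]

/-- Lagrange multipliers for a convex separable problem with a coupling constraint `∑ yᵢ = b`,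
under Slater's condition. -/
lemma exists_multiplier_of_isMin_sum {ι : Type*} [Fintype ι] {f : ι → E → ℝ}
    (hf : ∀ i, ConvexOn ℝ Set.univ (f i)) {Ω : ι → Set E} (hΩ : ∀ i, Convex ℝ (Ω i))
    {x y : ι → E} (hx : ∀ i, x i ∈ interior (Ω i)) (hxy : ∑ i, x i = ∑ i, y i)
    (hmin : ∀ z : ι → E, (∀ i, z i ∈ Ω i) → ∑ i, z i = ∑ i, y i →
      ∑ i, f i (y i) ≤ ∑ i, f i (z i)) :
    ∃ s : E, ∀ z : ι → E, (∀ i, z i ∈ Ω i) →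
      ∑ i, f i (y i) + ⟪s, ∑ i, z i - ∑ i, y i⟫ ≤ ∑ i, f i (z i) := by
  classical
  rcases isEmpty_or_nonempty ι with hι | ⟨⟨j⟩⟩
  · exact ⟨0, by simp⟩
  let φ : (ι → E) → ℝ := fun z => ∑ i, f i (z i)
  have hcont : Continuous φ := continuous_finsetSum _ fun i _ =>
    (continuousOn_univ.1 ((hf i).continuousOn isOpen_univ)).comp (continuous_apply i)
  let I : Set (ι → E) := Set.univ.pi fun i => interior (Ω i)
  have hI : Convex ℝ I := convex_pi fun i _ => (hΩ i).interior
  have hIo : IsOpen I := isOpen_set_pi Set.finite_univ fun _ _ => isOpen_interior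
  have hφ : ConvexOn ℝ I φ := by
    refine ⟨hI, fun p _ q _ a b ha hb hab => ?_⟩
    simp only [φ, smul_eq_mul, Finset.mul_sum, ← Finset.sum_add_distrib]
    exact Finset.sum_le_sum fun i _ =>
      (hf i).2 (Set.mem_univ _) (Set.mem_univ _) ha hb hab
  let A : Set ((ι → E) × ℝ) := {p | p.1 ∈ I ∧ φ p.1 < p.2}
  let B : Set ((ι → E) × ℝ) := {p | ∑ i, p.1 i = ∑ i, y i ∧ p.2 = φ y}
  have hA : Convex ℝ A := hφ.convex_strict_epigraph
  have hAo : IsOpen A := (hIo.preimage continuous_fst).inter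
    (isOpen_lt (hcont.comp continuous_fst) continuous_snd)
  have hB : Convex ℝ B := by
    rintro ⟨p, t⟩ ⟨hp, rfl⟩ ⟨q, r⟩ ⟨hq, rfl⟩ a b ha hb hab
    simp only at hp hq
    constructor
    · simp [Finset.sum_add_distrib, ← Finset.smul_sum, hp, hq, ← add_smul, hab]
    · simp [← add_mul, hab]
  have hAB : Disjoint A B := by
    rw [Set.disjoint_left]
    rintro ⟨p, t⟩ ⟨hpI, hpt⟩ ⟨hps, rfl⟩
    exact hpt.not_ge (hmin p (fun i => interior_subset (hpI i trivial)) hps)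
  obtain ⟨F, u, hFA, hFB⟩ := geometric_hahn_banach_open hA hAo hB hAB
  set L : StrongDual ℝ (ι → E) := F.comp (ContinuousLinearMap.inl ℝ (ι → E) ℝ)
  set c : ℝ := F (0, 1)
  have hF (z : ι → E) (t : ℝ) : F (z, t) = L z + c * t := by
    have : (z, t) = (z, (0 : ℝ)) + t • ((0 : ι → E), (1 : ℝ)) := by simp
    rw [this, map_add, map_smul, smul_eq_mul, mul_comm]
    rfl
  have hlow (z : ι → E) (hz : ∑ i, z i = ∑ i, y i) : u ≤ L z + c * φ y := by
    rw [← hF]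
    exact hFB _ ⟨hz, rfl⟩
  have hup (z : ι → E) (t : ℝ) (hz : z ∈ I) (ht : φ z < t) : L z + c * t < u := by
    rw [← hF]
    exact hFA _ ⟨hz, ht⟩
  have hxI : x ∈ I := fun i _ => hx i
  have hcneg : c < 0 := by
    have h1 := hup x (φ x + 1) hxI (by linarith)
    have h2 := hlow x hxy
    have h3 : φ y ≤ φ x := hmin x (fun i => interior_subset (hx i)) hxy
    by_contra! hc0
    nlinarith
  have hker (w : ι → E) (hw : ∑ i, w i = 0) : L w = 0 := by
    by_contra hne
    have h1 := hlow (y + ((u - 1 - c * φ y - L y) / L w) • w)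
      (by simp [Finset.sum_add_distrib, ← Finset.smul_sum, hw])
    rw [map_add, map_smul, smul_eq_mul, div_mul_cancel₀ _ hne] at h1
    linarith
  have hle (z : ι → E) (hz : z ∈ I) : L z + c * φ z ≤ u := by
    refine le_of_forall_pos_le_add fun ε hε => ?_
    have := hup z (φ z + ε / -c) hz (by linarith [div_pos hε (neg_pos.2 hcneg)])
    have hε' : c * (ε / -c) = -ε := by field_simp [hcneg.ne]
    linarith
  have hle' (z : ι → E) (hz : ∀ i, z i ∈ Ω i) : L z + c * φ z ≤ u := by
    have hcl : IsClosed {z : ι → E | L z + c * φ z ≤ u} :=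
      isClosed_le (L.continuous.add (continuous_const.mul hcont)) continuous_const
    refine closure_minimal hle hcl ?_
    rw [closure_pi_set]
    intro i _
    beta_reduce
    rw [(hΩ i).closure_interior_eq_closure_of_nonempty_interior ⟨x i, hx i⟩]
    exact subset_closure (hz i)
  obtain ⟨v, hv⟩ := (InnerProductSpace.toDual ℝ E).surjective
    (L.comp (ContinuousLinearMap.single ℝ (fun _ : ι => E) j))
  have hLv (w : ι → E) : L w = ⟪v, ∑ i, w i⟫ := by
    have h1 := hker (w - Pi.single j (∑ i, w i)) (by simp [Finset.sum_sub_distrib])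
    rw [map_sub, sub_eq_zero] at h1
    rw [h1, ← InnerProductSpace.toDual_apply_apply (𝕜 := ℝ), hv]
    rfl
  obtain ⟨s, rfl⟩ : ∃ s : E, v = (-c) • s :=
    ⟨(-c)⁻¹ • v, by rw [smul_inv_smul₀ (neg_pos.2 hcneg).ne']⟩
  refine ⟨s, fun z hz => le_of_mul_le_mul_left ?_ (neg_pos.2 hcneg)⟩
  have h1 := hle' z hz
  have h2 := hlow y rfl
  rw [hLv, real_inner_smul_left] at h1 h2
  rw [inner_sub_right]
  simp only [φ] at h1 h2
  linarith

end ConvexDuality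

/-- Optimality condition for the resource allocation problem: under Slater's condition,
a feasible-in-the-sets point `y*` is optimal iff it satisfies the resource constraint and
there is a common multiplier `s` such that, for each `i`, some subgradient `g_i` of `f_i`
at `y_i*` satisfies the variational inequality `⟪g_i − s, z − y_i*⟫ ≥ 0` for all `z ∈ Ω_i`. -/
theorem stmt_8 (n N : ℕ)
    (f : Fin N → EuclideanSpace ℝ (Fin n) → ℝ)
    (hf : ∀ i, ConvexOn ℝ Set.univ (f i))
    (Ω : Fin N → Set (EuclideanSpace ℝ (Fin n)))
    (hne : ∀ i, (Ω i).Nonempty) (hcl : ∀ i, IsClosed (Ω i)) (hconv : ∀ i, Convex ℝ (Ω i))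
    (d : Fin N → EuclideanSpace ℝ (Fin n))
    (hslater : ∃ x : Fin N → EuclideanSpace ℝ (Fin n),
      (∀ i, x i ∈ interior (Ω i)) ∧ ∑ i, x i = ∑ i, d i)
    (ystar : Fin N → EuclideanSpace ℝ (Fin n)) (hy : ∀ i, ystar i ∈ Ω i) :
    ((∑ i, ystar i = ∑ i, d i) ∧
      ∀ z : Fin N → EuclideanSpace ℝ (Fin n),
        (∀ i, z i ∈ Ω i) → ∑ i, z i = ∑ i, d i →
        ∑ i, f i (ystar i) ≤ ∑ i, f i (z i)) ↔
    ((∑ i, ystar i = ∑ i, d i) ∧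
      ∃ s : EuclideanSpace ℝ (Fin n), ∀ i, ∃ g : EuclideanSpace ℝ (Fin n),
        (∀ z, f i z ≥ f i (ystar i) + ⟪g, z - ystar i⟫) ∧
        ∀ z ∈ Ω i, ⟪g - s, z - ystar i⟫ ≥ 0) := by
  constructor
  · rintro ⟨hsum, hmin⟩
    obtain ⟨x, hx, hxd⟩ := hslater
    obtain ⟨s, hs⟩ := exists_multiplier_of_isMin_sum hf hconv hx (hxd.trans hsum.symm)
      fun z hz hzs => hmin z hz (hzs.trans hsum)
    refine ⟨hsum, s, fun i => (hf i).exists_subgradient_of_affine_le (hconv i) (hy i) ?_⟩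
    intro z hz
    have key := hs (Function.update ystar i z) fun k => by
      rcases eq_or_ne k i with rfl | hk
      · simpa using hz
      · simpa [hk] using hy k
    have hupd (G : Fin N → EuclideanSpace ℝ (Fin n) → ℝ) :
        ∑ k, G k (Function.update ystar i z k) - ∑ k, G k (ystar k) = G i z - G i (ystar i) := by
      rw [← Finset.sum_sub_distrib, Finset.sum_eq_single i] <;> simp +contextual
    have h1 := hupd f
    have h2 := hupd fun _ w => ⟪s, w⟫
    rw [inner_sub_right, inner_sum, inner_sum] at key
    rw [inner_sub_right]
    linarith
  · rintro ⟨hsum, s, hs⟩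
    refine ⟨hsum, fun z hz hzs => ?_⟩
    have hi (i : Fin N) : f i (ystar i) + ⟪s, z i - ystar i⟫ ≤ f i (z i) := by
      obtain ⟨g, hg, hgs⟩ := hs i
      have h1 := hg (z i)
      have h2 := hgs (z i) (hz i)
      rw [inner_sub_left] at h2
      linarith
    have h := Finset.sum_le_sum fun i (_ : i ∈ Finset.univ) => hi i
    rwa [Finset.sum_add_distrib, ← inner_sum, Finset.sum_sub_distrib, hzs, hsum, sub_self,
      inner_zero_right, add_zero] at h
end

section
/- (Equilibrium characterization for the first distributed algorithm over weight-balanced digraphs.) For i = 1,…,N let f_i : ℝⁿ → ℝ be convex, let Ω_i ⊆ ℝⁿ be nonempty closed convex, let d_i ∈ ℝⁿ, and assume Slater's condition. Let L be a real N×N matrix with L·1_N = 0, 1_Nᵀ·L = 0, and kernel equal to the span of 1_N (Laplacian of a strongly connected, weight-balanced digraph), and let k₁, k₂, k₃ > 0. Then for a family y* = (y_1*,…,y_N*) in ℝⁿ the following are equivalent: (A) there exist families x* = (x_i*), s* = (s_i*), w* = (w_i*) in ℝⁿ with Σᵢ w_i* = 0 such that for every i: (i) there is a subgradient g_i of f_i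 at y_i* with 0 = y_i* − x_i* − g_i + s_i*; (ii) k₁(w_i* − y_i* + d_i) = k₂·Σ_j L_ij s_j*; (iii) Σ_j L_ij (w_j* − y_j* + d_j) = 0; (iv) y_i* = P_{Ω_i}(x_i*), i.e., y_i* ∈ Ω_i and ‖x_i* − y_i*‖ ≤ ‖x_i* − z‖ for all z ∈ Ω_i; (B) y* is an optimal solution of the resource allocation problem. -/
open RealInnerProductSpace

theorem ContinuousLinearMap.apply_prod_real {G : Type*} [TopologicalSpace G] [AddCommGroup G]
    [Module ℝ G] (φ : G × ℝ →L[ℝ] ℝ) (v : G) (r : ℝ) : φ (v, r) = φ (v, 0) + r * φ (0, 1) := by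
  rw [← smul_eq_mul, ← map_smul, ← map_add]
  simp

theorem isOpen_strict_epigraph_inter {E : Type*} [TopologicalSpace E] {F : E → ℝ}
    (hF : Continuous F) {U : Set E} (hU : IsOpen U) : IsOpen {p : E × ℝ | p.1 ∈ U ∧ F p.1 < p.2} :=
  (hU.preimage continuous_fst).inter (isOpen_lt (hF.comp continuous_fst) continuous_snd)

/-- Fermat's rule: a minimizer of a continuous convex function `F` over a convex set `K` admits a
subgradient of `F` whose negative lies in the normal cone of `K`. -/
theorem ConvexOn.exists_subgradient_of_isMinOn {E : Type*} [NormedAddCommGroup E] [NormedSpace ℝ E]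
    {F : E → ℝ} (hF : ConvexOn ℝ Set.univ F) (hFc : Continuous F) {K : Set E} (hK : Convex ℝ K)
    {y : E} (hy : y ∈ K) (hmin : ∀ z ∈ K, F y ≤ F z) :
    ∃ g : E →L[ℝ] ℝ, (∀ z, F y + g (z - y) ≤ F z) ∧ ∀ z ∈ K, 0 ≤ g (z - y) := by
  obtain ⟨φ, c, hφ, hc⟩ := geometric_hahn_banach_open (t := K ×ˢ {F y})
    hF.convex_strict_epigraph (isOpen_strict_epigraph_inter hFc isOpen_univ)
    (hK.prod (convex_singleton _)) (by
      rw [Set.disjoint_left]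
      rintro ⟨z, r⟩ ⟨-, hr⟩ ⟨hz, rfl⟩
      exact (hmin z hz).not_gt hr)
  set β := φ (0, 1)
  have key : ∀ z r v, F z < r → v ∈ K → φ (z, 0) + r * β < φ (v, 0) + F y * β := by
    intro z r v hr hv
    rw [← φ.apply_prod_real, ← φ.apply_prod_real]
    exact (hφ (z, r) ⟨trivial, hr⟩).trans_le (hc (v, F y) ⟨hv, rfl⟩)
  have hβ : β < 0 := by linarith [key y (F y + 1) y (by linarith) hy]
  have key' : ∀ z v, v ∈ K → φ (z, 0) + F z * β ≤ φ (v, 0) + F y * β := by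
    intro z v hv
    refine le_of_forall_pos_le_add fun ε hε => ?_
    have h := key z (F z + ε / (-β)) v (by linarith [div_pos hε (neg_pos.2 hβ)]) hv
    have : ε / (-β) * β = -ε := by
      rw [div_neg, neg_mul, div_mul_cancel₀ _ hβ.ne]
    linarith
  have hsub : ∀ z v : E, φ (z - v, 0) = φ (z, 0) - φ (v, 0) := fun z v => by
    rw [← map_sub]; simp
  refine ⟨(-β)⁻¹ • φ.comp (.inl ℝ E ℝ), fun z => ?_, fun z hz => ?_⟩
  · have h := key' z y hy
    have : (-β)⁻¹ * φ (z - y, 0) ≤ F z - F y := by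
      rw [inv_mul_le_iff₀ (neg_pos.2 hβ), hsub]
      linarith
    simpa using (by linarith : F y + (-β)⁻¹ * φ (z - y, 0) ≤ F z)
  · have h := key' y z hz
    have : 0 ≤ (-β)⁻¹ * φ (z - y, 0) :=
      mul_nonneg (inv_nonneg.2 (neg_pos.2 hβ).le) (by rw [hsub]; linarith)
    simpa using this

/-- Existence of a Lagrange multiplier for the constraint `A z = b` under Slater's condition. -/
theorem ConvexOn.exists_multiplier_of_isMinOn {E G : Type*} [NormedAddCommGroup E]
    [NormedSpace ℝ E] [CompleteSpace E] [NormedAddCommGroup G] [NormedSpace ℝ G] [CompleteSpace G]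
    {F : E → ℝ} (hF : ConvexOn ℝ Set.univ F) (hFc : Continuous F) {K : Set E} (hK : Convex ℝ K)
    (A : E →L[ℝ] G) (hA : Function.Surjective A) {b : G} {x y : E} (hx : x ∈ interior K)
    (hxb : A x = b) (hmin : ∀ z ∈ K, A z = b → F y ≤ F z) :
    ∃ s : G →L[ℝ] ℝ, ∀ z ∈ K, F y + s (A z - b) ≤ F z := by
  let B : E × ℝ →L[ℝ] G × ℝ := A.prodMap (.id ℝ ℝ)
  have hB : IsOpenMap B := B.isOpenMap (hA.prodMap Function.surjective_id)
  obtain ⟨φ, hφ⟩ := geometric_hahn_banach_open_point (x := (b, F y))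
    (s := B '' {p : E × ℝ | p.1 ∈ interior K ∧ F p.1 < p.2})
    ((hF.subset (Set.subset_univ _) hK.interior).convex_strict_epigraph.linear_image
      B.toLinearMap)
    (hB _ (isOpen_strict_epigraph_inter hFc isOpen_interior)) (by
      rintro ⟨⟨z, r⟩, ⟨hz, hr⟩, h⟩
      obtain ⟨h₁, h₂⟩ := Prod.ext_iff.1 h
      have h₂ : r = F y := h₂
      exact (hmin z (interior_subset hz) h₁).not_gt (h₂ ▸ hr))
  set β := φ (0, 1)
  have key : ∀ z r, z ∈ interior K → F z < r → φ (A z, 0) + r * β < φ (b, 0) + F y * β := by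
    intro z r hz hr
    rw [← φ.apply_prod_real, ← φ.apply_prod_real]
    exact hφ _ ⟨(z, r), ⟨hz, hr⟩, rfl⟩
  have hβ : β < 0 := by
    have h := key x (max (F x) (F y) + 1) hx (by linarith [le_max_left (F x) (F y)])
    rw [hxb] at h
    nlinarith [le_max_right (F x) (F y)]
  have hint : ∀ z ∈ interior K, F y + (-β)⁻¹ * φ (A z - b, 0) ≤ F z := by
    intro z hz
    refine le_of_forall_gt_imp_ge_of_dense fun r hr => ?_
    have h := key z r hz hr
    have hsub : φ (A z - b, 0) = φ (A z, 0) - φ (b, 0) := by rw [← map_sub]; simp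
    have : (-β)⁻¹ * φ (A z - b, 0) ≤ r - F y := by
      rw [inv_mul_le_iff₀ (neg_pos.2 hβ), hsub]
      linarith
    linarith
  refine ⟨(-β)⁻¹ • φ.comp (.inl ℝ G ℝ), fun z hz => ?_⟩
  have hz' : z ∈ closure (interior K) :=
    hK.closure_interior_eq_closure_of_nonempty_interior ⟨x, hx⟩ ▸ subset_closure hz
  have hcl : IsClosed {z | F y + (-β)⁻¹ * φ (A z - b, 0) ≤ F z} :=
    isClosed_le (by fun_prop) hFc
  have h : F y + (-β)⁻¹ * φ (A z - b, 0) ≤ F z := closure_minimal hint hcl hz'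
  simpa using h

theorem norm_sub_le_iff_inner_nonpos {E : Type*} [NormedAddCommGroup E] [InnerProductSpace ℝ E]
    {K : Set E} (hK : Convex ℝ K) {x y : E} (hy : y ∈ K) :
    (∀ z ∈ K, ‖x - y‖ ≤ ‖x - z‖) ↔ ∀ z ∈ K, ⟪x - y, z - y⟫ ≤ 0 := by
  rw [← norm_eq_iInf_iff_real_inner_le_zero hK hy]
  have : Nonempty K := ⟨⟨y, hy⟩⟩
  have hbdd : BddBelow (Set.range fun w : K => ‖x - w‖) :=
    ⟨0, by rintro _ ⟨w, rfl⟩; exact norm_nonneg _⟩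
  refine ⟨fun h => le_antisymm (le_ciInf fun w => h w w.2) (ciInf_le hbdd ⟨y, hy⟩), fun h z hz => ?_⟩
  rw [h]
  exact ciInf_le hbdd ⟨z, hz⟩

theorem ConvexOn.exists_common_multiplier {E ι : Type*} [NormedAddCommGroup E]
    [InnerProductSpace ℝ E] [FiniteDimensional ℝ E] [Fintype ι] {f : ι → E → ℝ}
    (hf : ∀ i, ConvexOn ℝ Set.univ (f i)) {Ω : ι → Set E} (hΩ : ∀ i, Convex ℝ (Ω i)) {b : E}
    {x y : ι → E} (hx : ∀ i, x i ∈ interior (Ω i)) (hxb : ∑ i, x i = b) (hy : ∀ i, y i ∈ Ω i)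
    (hyb : ∑ i, y i = b)
    (hmin : ∀ z : ι → E, (∀ i, z i ∈ Ω i) → ∑ i, z i = b → ∑ i, f i (y i) ≤ ∑ i, f i (z i)) :
    ∃ s : E, ∀ i, ∀ z ∈ Ω i, f i (y i) + ⟪s, z - y i⟫ ≤ f i z := by
  classical
  cases isEmpty_or_nonempty ι
  · exact ⟨0, isEmptyElim⟩
  have : CompleteSpace E := FiniteDimensional.complete ℝ E
  have hfc : ∀ i, Continuous (f i) := fun i =>
    continuousOn_univ.1 ((hf i).continuousOn isOpen_univ)
  let A : (ι → E) →L[ℝ] E := ∑ i, ContinuousLinearMap.proj i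
  have hA : ∀ z, A z = ∑ i, z i := fun z => by simp [A]
  have hF : ConvexOn ℝ Set.univ fun z : ι → E => ∑ i, f i (z i) := by
    refine ⟨convex_univ, fun z _ w _ a c ha hc hac => ?_⟩
    simp only [Finset.smul_sum, ← Finset.sum_add_distrib]
    exact Finset.sum_le_sum fun i _ => (hf i).2 trivial trivial ha hc hac
  obtain ⟨s, hs⟩ := hF.exists_multiplier_of_isMinOn (b := b) (x := x) (y := y)
    (K := Set.univ.pi Ω) (by fun_prop) (convex_pi fun i _ => hΩ i) A
    (fun v => ⟨Pi.single (Classical.arbitrary ι) v, by rw [hA, Finset.sum_pi_single']; simp⟩)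
    (by simpa [interior_pi_set Set.finite_univ] using hx) (by rw [hA, hxb])
    (fun z hz hzb => hmin z (by simpa using hz) (by rw [← hA, hzb]))
  refine ⟨(InnerProductSpace.toDual ℝ E).symm s, fun i z hz => ?_⟩
  have h := hs (Function.update y i z) fun j _ => by
    obtain rfl | hj := eq_or_ne j i
    · simpa using hz
    · simpa [hj] using hy j
  have e₁ : A (Function.update y i z) - b = z - y i := by
    rw [hA, ← hyb, ← Finset.sum_sub_distrib, Finset.sum_eq_single i] <;> simp +contextual
  have e₂ : ∑ j, f j (Function.update y i z j) - ∑ j, f j (y j) = f i z - f i (y i) := by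
    rw [← Finset.sum_sub_distrib, Finset.sum_eq_single i] <;> simp +contextual
  rw [e₁] at h
  rw [InnerProductSpace.toDual_symm_apply]
  linarith

/-- Karush–Kuhn–Tucker conditions for the resource allocation problem. -/
theorem ConvexOn.exists_kkt_multiplier {E ι : Type*} [NormedAddCommGroup E]
    [InnerProductSpace ℝ E] [FiniteDimensional ℝ E] [Fintype ι] {f : ι → E → ℝ}
    (hf : ∀ i, ConvexOn ℝ Set.univ (f i)) {Ω : ι → Set E} (hΩ : ∀ i, Convex ℝ (Ω i)) {b : E}
    {x y : ι → E} (hx : ∀ i, x i ∈ interior (Ω i)) (hxb : ∑ i, x i = b) (hy : ∀ i, y i ∈ Ω i)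
    (hyb : ∑ i, y i = b)
    (hmin : ∀ z : ι → E, (∀ i, z i ∈ Ω i) → ∑ i, z i = b → ∑ i, f i (y i) ≤ ∑ i, f i (z i)) :
    ∃ (s : E) (g : ι → E), ∀ i, (∀ z, f i (y i) + ⟪g i, z - y i⟫ ≤ f i z) ∧
      ∀ z ∈ Ω i, ⟪s - g i, z - y i⟫ ≤ 0 := by
  obtain ⟨s, hs⟩ := exists_common_multiplier hf hΩ hx hxb hy hyb hmin
  have : CompleteSpace E := FiniteDimensional.complete ℝ E
  have hg : ∀ i, ∃ g : E, (∀ z, f i (y i) + ⟪g, z - y i⟫ ≤ f i z) ∧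
      ∀ z ∈ Ω i, ⟪s - g, z - y i⟫ ≤ 0 := by
    intro i
    have hlin : ConcaveOn ℝ Set.univ fun z : E => ⟪s, z⟫ :=
      (innerₛₗ ℝ s).concaveOn convex_univ
    have hF := (hf i).sub hlin
    obtain ⟨g, hg, hg'⟩ := hF.exists_subgradient_of_isMinOn
      (continuousOn_univ.1 (hF.continuousOn isOpen_univ)) (hΩ i) (hy i) fun z hz => by
        have h := hs i z hz
        rw [inner_sub_right] at h
        simp only [Pi.sub_apply]
        linarith
    refine ⟨s + (InnerProductSpace.toDual ℝ E).symm g, fun z => ?_, fun z hz => ?_⟩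
    · have h := hg z
      simp only [Pi.sub_apply] at h
      rw [inner_add_left, InnerProductSpace.toDual_symm_apply, inner_sub_right]
      linarith
    · have h := hg' z hz
      rw [sub_add_cancel_left, inner_neg_left, InnerProductSpace.toDual_symm_apply]
      linarith
  choose g hg using hg
  exact ⟨s, g, hg⟩

theorem Matrix.exists_const_of_sum_smul_eq_zero {ι κ : Type*} [Fintype ι] {L : Matrix ι ι ℝ}
    (hker : ∀ x : ι → ℝ, L.mulVec x = 0 → ∃ c : ℝ, x = fun _ => c)
    {v : ι → EuclideanSpace ℝ κ} (hv : ∀ i, ∑ j, L i j • v j = 0) :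
    ∃ c : EuclideanSpace ℝ κ, ∀ i, v i = c := by
  have h : ∀ k, ∃ c : ℝ, (fun i => v i k) = fun _ => c := fun k => hker _ <| by
    ext i
    simpa [Matrix.mulVec, dotProduct] using congrArg (fun w => w k) (hv i)
  choose c hc using h
  exact ⟨WithLp.toLp 2 c, fun i => by ext k; exact congrFun (hc k) i⟩

/-- Equilibrium characterization for the first distributed algorithm over strongly connected,
weight-balanced digraphs: `(y_i*)` arises from an equilibrium `(x*, s*, w*)` of the dynamics
(with `Σᵢ w_i* = 0`) if and only if `y*` is an optimal solution of the resource allocation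
problem. -/
theorem stmt_14 (n N : ℕ)
    (f : Fin N → EuclideanSpace ℝ (Fin n) → ℝ)
    (hf : ∀ i, ConvexOn ℝ Set.univ (f i))
    (Ω : Fin N → Set (EuclideanSpace ℝ (Fin n)))
    (hne : ∀ i, (Ω i).Nonempty) (hcl : ∀ i, IsClosed (Ω i)) (hconv : ∀ i, Convex ℝ (Ω i))
    (d : Fin N → EuclideanSpace ℝ (Fin n))
    (hslater : ∃ x : Fin N → EuclideanSpace ℝ (Fin n),
      (∀ i, x i ∈ interior (Ω i)) ∧ ∑ i, x i = ∑ i, d i)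
    (L : Matrix (Fin N) (Fin N) ℝ)
    (hL1 : L.mulVec (fun _ => (1 : ℝ)) = 0)
    (h1L : Matrix.vecMul (fun _ => (1 : ℝ)) L = 0)
    (hker : ∀ x : Fin N → ℝ, L.mulVec x = 0 ↔ ∃ c : ℝ, x = fun _ => c)
    (k₁ k₂ k₃ : ℝ) (hk₁ : 0 < k₁) (hk₂ : 0 < k₂) (hk₃ : 0 < k₃)
    (ystar : Fin N → EuclideanSpace ℝ (Fin n)) :
    (∃ xstar sstar wstar : Fin N → EuclideanSpace ℝ (Fin n),
      (∑ i, wstar i = 0) ∧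
      ∀ i,
        (∃ g : EuclideanSpace ℝ (Fin n),
          (∀ z, f i z ≥ f i (ystar i) + ⟪g, z - ystar i⟫) ∧
          (0 : EuclideanSpace ℝ (Fin n)) = ystar i - xstar i - g + sstar i) ∧
        (k₁ • (wstar i - ystar i + d i) = k₂ • ∑ j, L i j • sstar j) ∧
        (∑ j, L i j • (wstar j - ystar j + d j) = 0) ∧
        (ystar i ∈ Ω i ∧ ∀ z ∈ Ω i, ‖xstar i - ystar i‖ ≤ ‖xstar i - z‖)) ↔
    ((∀ i, ystar i ∈ Ω i) ∧ (∑ i, ystar i = ∑ i, d i) ∧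
      ∀ z : Fin N → EuclideanSpace ℝ (Fin n),
        (∀ i, z i ∈ Ω i) → ∑ i, z i = ∑ i, d i →
        ∑ i, f i (ystar i) ≤ ∑ i, f i (z i)) := by
  have hcol : ∀ v : Fin N → EuclideanSpace ℝ (Fin n), ∑ i, ∑ j, L i j • v j = 0 := by
    intro v
    rw [Finset.sum_comm]
    refine Finset.sum_eq_zero fun j _ => ?_
    have h : ∑ i, L i j = 0 := by simpa [Matrix.vecMul, dotProduct] using congrFun h1L j
    rw [← Finset.sum_smul, h, zero_smul]
  constructor
  · rintro ⟨x, s, w, hw, h⟩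
    have hres : ∑ i, (w i - ystar i + d i) = 0 := by
      have e : k₁ • ∑ i, (w i - ystar i + d i) = 0 := by
        rw [Finset.smul_sum, Finset.sum_congr rfl fun i _ => (h i).2.1, ← Finset.smul_sum, hcol,
          smul_zero]
      exact (smul_eq_zero.1 e).resolve_left hk₁.ne'
    have hsum : ∑ i, ystar i = ∑ i, d i := by
      rw [Finset.sum_add_distrib, Finset.sum_sub_distrib, hw, zero_sub, neg_add_eq_zero] at hres
      exact hres
    obtain ⟨c, hc⟩ := Matrix.exists_const_of_sum_smul_eq_zero (fun v => (hker v).1)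
      fun i => (h i).2.2.1
    have hzero : ∀ i, w i - ystar i + d i = 0 := by
      intro i
      have hN : N ≠ 0 := by rintro rfl; exact i.elim0
      have e : (N : ℝ) • c = 0 := by
        rw [Finset.sum_congr rfl fun i _ => hc i] at hres
        simpa [Nat.cast_smul_eq_nsmul] using hres
      rw [hc i]
      exact (smul_eq_zero.1 e).resolve_left (Nat.cast_ne_zero.2 hN)
    obtain ⟨σ, hσ⟩ := Matrix.exists_const_of_sum_smul_eq_zero (v := s) (fun v => (hker v).1)
      fun i => by
        have e := (h i).2.1
        rw [hzero i, smul_zero] at e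
        exact (smul_eq_zero.1 e.symm).resolve_left hk₂.ne'
    refine ⟨fun i => (h i).2.2.2.1, hsum, fun z hz hzsum => ?_⟩
    have hi : ∀ i, f i (ystar i) + ⟪σ, z i - ystar i⟫ ≤ f i (z i) := by
      intro i
      obtain ⟨⟨g, hg, hx⟩, -, -, hy, hp⟩ := h i
      have h₁ := (norm_sub_le_iff_inner_nonpos (hconv i) hy).1 hp (z i) (hz i)
      have e : x i - ystar i = σ - g := by
        rw [hσ i] at hx
        rw [← sub_eq_zero, ← neg_eq_zero, hx]
        abel
      rw [e, inner_sub_left] at h₁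
      linarith [hg (z i)]
    have h₂ := Finset.sum_le_sum fun i (_ : i ∈ Finset.univ) => hi i
    rw [Finset.sum_add_distrib, ← inner_sum, Finset.sum_sub_distrib, hzsum, hsum, sub_self,
      inner_zero_right, add_zero] at h₂
    exact h₂
  · rintro ⟨hy, hsum, hmin⟩
    obtain ⟨x₀, hx₀, hx₀sum⟩ := hslater
    obtain ⟨s, g, hsg⟩ := ConvexOn.exists_kkt_multiplier hf hconv hx₀ hx₀sum hy hsum hmin
    have hrow : ∀ i, ∑ j, L i j • s = 0 := by
      intro i
      have h : ∑ j, L i j = 0 := by simpa [Matrix.mulVec, dotProduct] using congrFun hL1 i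
      rw [← Finset.sum_smul, h, zero_smul]
    refine ⟨fun i => ystar i - g i + s, fun _ => s, fun i => ystar i - d i, by simp [hsum],
      fun i => ⟨⟨g i, (hsg i).1, by beta_reduce; abel⟩, by simp [hrow], by simp, hy i, ?_⟩⟩
    refine (norm_sub_le_iff_inner_nonpos (hconv i) (hy i)).2 fun z hz => ?_
    have e : ystar i - g i + s - ystar i = s - g i := by abel
    rw [e]
    exact (hsg i).2 z hz
end
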